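/- arXiv:2411.06533 — 2 statements merged into one kernel-verified Lean document; each statement's English description precedes it below -/
import Mathlib

section
/- Define K_α(z) := ∫₀^∞ e^{−z cosh t} cosh(αt) dt for z > 0, a₁(z) := K₃(z)/K₂(z), a₂(z) := −a₁(z)² + 6a₁(z)/z + 1, a₃(z) := −a₁(z)³ + 6a₁(z)²/z − 6a₁(z)/z² + a₁(z) − 1/z. Then lim_{z→+∞} (z·a₂(z) − a₁(z)) / (z·a₃(z)) = 5/3. -/
open MeasureTheory Filter

/-- The modified Bessel function K_α(z) = ∫₀^∞ e^{−z cosh t} cosh(αt) dt. -/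
noncomputable def Kb (α z : ℝ) : ℝ :=
  ∫ t in Set.Ioi (0 : ℝ), Real.exp (-z * Real.cosh t) * Real.cosh (α * t)

noncomputable def aOne (z : ℝ) : ℝ := Kb 3 z / Kb 2 z

noncomputable def aTwo (z : ℝ) : ℝ := -aOne z ^ 2 + 6 * aOne z / z + 1

noncomputable def aThree (z : ℝ) : ℝ :=
  -aOne z ^ 3 + 6 * aOne z ^ 2 / z - 6 * aOne z / z ^ 2 + aOne z - 1 / z

/-- The moments `∫₀^∞ e^{−z cosh t} (cosh t − 1)ⁿ dt`. -/
noncomputable def coshMoment (n : ℕ) (z : ℝ) : ℝ :=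
  ∫ t in Set.Ioi (0 : ℝ), Real.exp (-z * Real.cosh t) * (Real.cosh t - 1) ^ n

lemma exp_neg_mul_cosh_mul_cosh_pow_le {z t : ℝ} (hz : 0 < z) (ht : 0 ≤ t) (n : ℕ) :
    Real.exp (-z * Real.cosh t) * Real.cosh t ^ n ≤
      Real.exp (((n : ℝ) + 1) ^ 2 / z) * Real.exp (-1 * t) := by
  have hcosh : Real.cosh t ≤ Real.exp t := by
    rw [Real.cosh_eq]
    have : Real.exp (-t) ≤ Real.exp t := Real.exp_le_exp.2 (by linarith)
    linarith
  have hlow : t ^ 2 / 4 ≤ Real.cosh t := by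
    rw [Real.cosh_eq]
    have h1 := Real.quadratic_le_exp_of_nonneg ht
    have h2 := Real.exp_pos (-t)
    linarith
  calc Real.exp (-z * Real.cosh t) * Real.cosh t ^ n
      ≤ Real.exp (-z * (t ^ 2 / 4)) * Real.exp t ^ n := by
        have := Real.cosh_pos t
        gcongr ?_ * ?_
        · exact Real.exp_le_exp.2 (by nlinarith)
        · gcongr
    _ = Real.exp (-z * (t ^ 2 / 4) + n * t) := by rw [← Real.exp_nat_mul, ← Real.exp_add]
    _ ≤ Real.exp (((n : ℝ) + 1) ^ 2 / z + -1 * t) := by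
        apply Real.exp_le_exp.2
        have key : ((n : ℝ) + 1) ^ 2 / z + -1 * t - (-z * (t ^ 2 / 4) + n * t) =
            ((n : ℝ) + 1 - z * t / 2) ^ 2 / z := by
          field_simp
          ring
        have : 0 ≤ ((n : ℝ) + 1 - z * t / 2) ^ 2 / z := by positivity
        linarith
    _ = _ := Real.exp_add _ _

lemma integrableOn_exp_neg_mul_cosh_mul {z : ℝ} (hz : 0 < z) {f : ℝ → ℝ} (hf : Continuous f)
    (n : ℕ) (hbound : ∀ t, |f t| ≤ Real.cosh t ^ n) :
    IntegrableOn (fun t => Real.exp (-z * Real.cosh t) * f t) (Set.Ioi 0) := by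
  refine integrable_of_isBigO_exp_neg (b := 1) one_pos
    (Continuous.continuousOn (by fun_prop)) ?_
  refine Asymptotics.IsBigO.of_bound (Real.exp (((n : ℝ) + 1) ^ 2 / z)) ?_
  filter_upwards [eventually_ge_atTop 0] with t ht
  rw [Real.norm_eq_abs, Real.norm_eq_abs, abs_mul, Real.abs_exp, Real.abs_exp]
  exact (mul_le_mul_of_nonneg_left (hbound t) (Real.exp_pos _).le).trans
    (exp_neg_mul_cosh_mul_cosh_pow_le hz ht n)

lemma abs_cosh_sub_one_pow_le (n : ℕ) (t : ℝ) : |(Real.cosh t - 1) ^ n| ≤ Real.cosh t ^ n := by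
  have h := Real.one_le_cosh t
  rw [abs_of_nonneg (pow_nonneg (by linarith) n)]
  exact pow_le_pow_left₀ (by linarith) (by linarith) n

lemma integrableOn_coshMoment {z : ℝ} (hz : 0 < z) (n : ℕ) :
    IntegrableOn (fun t => Real.exp (-z * Real.cosh t) * (Real.cosh t - 1) ^ n) (Set.Ioi 0) :=
  integrableOn_exp_neg_mul_cosh_mul hz (by fun_prop) n (abs_cosh_sub_one_pow_le n)

lemma coshMoment_nonneg (n : ℕ) (z : ℝ) : 0 ≤ coshMoment n z :=
  integral_nonneg fun t =>
    mul_nonneg (Real.exp_pos _).le (pow_nonneg (by linarith [Real.one_le_cosh t]) n)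

lemma coshMoment_zero_pos {z : ℝ} (hz : 0 < z) : 0 < coshMoment 0 z := by
  have hint := integrableOn_coshMoment hz 0
  unfold coshMoment
  rw [setIntegral_pos_iff_support_of_nonneg_ae
    (Eventually.of_forall fun t => by simpa using (Real.exp_pos _).le) hint]
  have : Function.support (fun t => Real.exp (-z * Real.cosh t) * (Real.cosh t - 1) ^ 0) =
      Set.univ := by
    ext t
    simp
  rw [this]
  simp

/-- The three-term recurrence obtained by integrating the derivative of
`e^{−z cosh t} (cosh t − 1)ⁿ sinh t`. -/
lemma coshMoment_recurrence {z : ℝ} (hz : 0 < z) (n : ℕ) :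
    z * (coshMoment (n + 2) z + 2 * coshMoment (n + 1) z) =
      (n + 1) * coshMoment (n + 1) z + (2 * n + 1) * coshMoment n z := by
  have i0 := (integrableOn_coshMoment hz n).const_mul (2 * (n : ℝ) + 1)
  have i1 := (integrableOn_coshMoment hz (n + 1)).const_mul ((n : ℝ) + 1 - 2 * z)
  have i2 := (integrableOn_coshMoment hz (n + 2)).const_mul (-z)
  have hderiv : ∀ t ∈ Set.Ici (0 : ℝ), HasDerivAt
      (fun t => Real.exp (-z * Real.cosh t) * ((Real.cosh t - 1) ^ n * Real.sinh t))
      ((2 * (n : ℝ) + 1) * (Real.exp (-z * Real.cosh t) * (Real.cosh t - 1) ^ n) +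
        ((n : ℝ) + 1 - 2 * z) * (Real.exp (-z * Real.cosh t) * (Real.cosh t - 1) ^ (n + 1)) +
        -z * (Real.exp (-z * Real.cosh t) * (Real.cosh t - 1) ^ (n + 2))) t := by
    intro t _
    have h := (((Real.hasDerivAt_cosh t).const_mul (-z)).exp).mul
      ((((Real.hasDerivAt_cosh t).sub_const 1).pow n).mul (Real.hasDerivAt_sinh t))
    refine h.congr_deriv ?_
    have hs : Real.sinh t ^ 2 = Real.cosh t ^ 2 - 1 := Real.sinh_sq t
    rcases n with _ | n
    · simp
      linear_combination (-z * Real.exp (-(z * Real.cosh t))) * hs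
    · simp only [Pi.pow_apply, Nat.add_sub_cancel, Pi.mul_apply]
      push_cast
      linear_combination (-z * Real.exp (-z * Real.cosh t) * (Real.cosh t - 1) ^ (n + 1) +
        Real.exp (-z * Real.cosh t) * (n + 1) * (Real.cosh t - 1) ^ n) * hs
  have hlim : Tendsto
      (fun t => Real.exp (-z * Real.cosh t) * ((Real.cosh t - 1) ^ n * Real.sinh t))
      atTop (nhds 0) := by
    have hexp : Tendsto (fun t : ℝ => Real.exp ((((n + 1 : ℕ) : ℝ) + 1) ^ 2 / z) *
        Real.exp (-1 * t)) atTop (nhds 0) := by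
      simpa using (Real.tendsto_exp_neg_atTop_nhds_zero).const_mul
        (Real.exp ((((n + 1 : ℕ) : ℝ) + 1) ^ 2 / z))
    refine squeeze_zero_norm' ?_ hexp
    filter_upwards [eventually_ge_atTop 0] with t ht
    refine le_trans ?_ (exp_neg_mul_cosh_mul_cosh_pow_le hz ht (n + 1))
    have hsinh : |Real.sinh t| ≤ Real.cosh t := by
      rw [abs_of_nonneg (Real.sinh_nonneg_iff.2 ht)]
      exact (Real.sinh_lt_cosh t).le
    rw [Real.norm_eq_abs, abs_mul, Real.abs_exp, abs_mul, pow_succ]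
    gcongr
    exact abs_cosh_sub_one_pow_le n t
  have hsum := integral_add' (i0.add i1) i2
  rw [integral_add' i0 i1, integral_const_mul, integral_const_mul, integral_const_mul] at hsum
  have h := hsum.symm.trans
    (integral_Ioi_of_hasDerivAt_of_tendsto' hderiv ((i0.add i1).add i2) hlim)
  simp only [Real.sinh_zero, mul_zero, sub_zero] at h
  change (2 * (n : ℝ) + 1) * coshMoment n z + ((n : ℝ) + 1 - 2 * z) * coshMoment (n + 1) z +
    -z * coshMoment (n + 2) z = 0 at h
  linarith

lemma Kb_two_eq {z : ℝ} (hz : 0 < z) :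
    Kb 2 z = coshMoment 0 z + 4 * coshMoment 1 z + 2 * coshMoment 2 z := by
  have i0 := integrableOn_coshMoment hz 0
  have i1 := (integrableOn_coshMoment hz 1).const_mul 4
  have i2 := (integrableOn_coshMoment hz 2).const_mul 2
  simp only [Kb, coshMoment]
  rw [← integral_const_mul, ← integral_const_mul, ← integral_add' i0 i1,
    ← integral_add' (i0.add i1) i2]
  congr 1 with t
  rw [Real.cosh_two_mul, Real.sinh_sq]
  simp only [Pi.add_apply]
  ring

lemma Kb_three_eq {z : ℝ} (hz : 0 < z) :
    Kb 3 z = coshMoment 0 z + 9 * coshMoment 1 z + 12 * coshMoment 2 z +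
      4 * coshMoment 3 z := by
  have i0 := integrableOn_coshMoment hz 0
  have i1 := (integrableOn_coshMoment hz 1).const_mul 9
  have i2 := (integrableOn_coshMoment hz 2).const_mul 12
  have i3 := (integrableOn_coshMoment hz 3).const_mul 4
  simp only [Kb, coshMoment]
  rw [← integral_const_mul, ← integral_const_mul, ← integral_const_mul, ← integral_add' i0 i1,
    ← integral_add' (i0.add i1) i2, ← integral_add' ((i0.add i1).add i2) i3]
  congr 1 with t
  rw [Real.cosh_three_mul]
  simp only [Pi.add_apply]
  ring

/-- The moment `coshMoment n z` rescaled by its order of magnitude `coshMoment 0 z / z ^ n`. -/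
noncomputable def scaledMoment (n : ℕ) (z : ℝ) : ℝ :=
  z ^ n * coshMoment n z / coshMoment 0 z

lemma scaledMoment_nonneg {z : ℝ} (hz : 0 < z) (n : ℕ) : 0 ≤ scaledMoment n z :=
  div_nonneg (mul_nonneg (by positivity) (coshMoment_nonneg n z)) (coshMoment_nonneg 0 z)

lemma scaledMoment_recurrence {z : ℝ} (hz : 0 < z) (n : ℕ) :
    2 * scaledMoment (n + 1) z = (2 * n + 1) * scaledMoment n z +
      z⁻¹ * ((n + 1) * scaledMoment (n + 1) z - scaledMoment (n + 2) z) := by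
  have h := coshMoment_recurrence hz n
  have h0 := (coshMoment_zero_pos hz).ne'
  unfold scaledMoment
  field_simp
  linear_combination z ^ (n + 1) * h

lemma scaledMoment_succ_le {z : ℝ} (n : ℕ) (hz : (n : ℝ) + 1 ≤ z) :
    scaledMoment (n + 1) z ≤ (2 * n + 1) * scaledMoment n z := by
  have hz0 : 0 < z := lt_of_lt_of_le (by positivity) hz
  have h := scaledMoment_recurrence hz0 n
  have h1 := scaledMoment_nonneg hz0 (n + 1)
  have h2 := mul_nonneg (inv_pos.2 hz0).le (scaledMoment_nonneg hz0 (n + 2))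
  have h3 : z⁻¹ * ((n : ℝ) + 1) ≤ 1 := by
    rw [inv_mul_le_iff₀ hz0]
    linarith
  nlinarith

lemma exists_eventually_scaledMoment_le (n : ℕ) :
    ∃ C : ℝ, ∀ᶠ z in atTop, scaledMoment n z ≤ C := by
  induction n with
  | zero =>
    refine ⟨1, ?_⟩
    filter_upwards [eventually_gt_atTop 0] with z hz
    simp [scaledMoment, (coshMoment_zero_pos hz).ne']
  | succ n ih =>
    obtain ⟨C, hC⟩ := ih
    refine ⟨(2 * n + 1) * C, ?_⟩
    filter_upwards [hC, eventually_ge_atTop ((n : ℝ) + 1)] with z h hz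
    exact (scaledMoment_succ_le n hz).trans (by gcongr)

lemma tendsto_inv_mul_scaledMoment (n : ℕ) :
    Tendsto (fun z => z⁻¹ * scaledMoment n z) atTop (nhds 0) := by
  obtain ⟨C, hC⟩ := exists_eventually_scaledMoment_le n
  have h : Tendsto (fun z : ℝ => z⁻¹ * C) atTop (nhds 0) := by
    simpa using tendsto_inv_atTop_zero.mul_const C
  refine squeeze_zero' ?_ ?_ h
  · filter_upwards [eventually_gt_atTop 0] with z hz
    exact mul_nonneg (inv_pos.2 hz).le (scaledMoment_nonneg hz n)
  · filter_upwards [hC, eventually_gt_atTop 0] with z h hz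
    exact mul_le_mul_of_nonneg_left h (inv_pos.2 hz).le

lemma tendsto_scaledMoment_succ {n : ℕ} {l : ℝ}
    (h : Tendsto (scaledMoment n) atTop (nhds l)) :
    Tendsto (scaledMoment (n + 1)) atTop (nhds ((2 * n + 1) / 2 * l)) := by
  have h' := (h.const_mul ((2 * (n : ℝ) + 1) / 2)).add
    (((tendsto_inv_mul_scaledMoment (n + 1)).const_mul (((n : ℝ) + 1) / 2)).sub
      ((tendsto_inv_mul_scaledMoment (n + 2)).const_mul (1 / 2)))
  simp only [mul_zero, sub_zero, add_zero] at h'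
  refine h'.congr' ?_
  filter_upwards [eventually_gt_atTop 0] with z hz
  linear_combination (-1 / 2) * scaledMoment_recurrence hz n

lemma tendsto_scaledMoment_one : Tendsto (scaledMoment 1) atTop (nhds (1 / 2)) := by
  have h0 : Tendsto (scaledMoment 0) atTop (nhds 1) := by
    refine tendsto_const_nhds.congr' ?_
    filter_upwards [eventually_gt_atTop 0] with z hz
    simp [scaledMoment, (coshMoment_zero_pos hz).ne']
  simpa using tendsto_scaledMoment_succ h0

lemma tendsto_scaledMoment_two : Tendsto (scaledMoment 2) atTop (nhds (3 / 4)) := by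
  convert tendsto_scaledMoment_succ tendsto_scaledMoment_one using 2
  norm_num

lemma aOne_eq {z : ℝ} (hz : 0 < z) :
    z ^ 2 * (aOne z - 1 - 5 / 2 * z⁻¹) =
      (5 / 2 * (scaledMoment 1 z - scaledMoment 2 z) + 10 * scaledMoment 2 z -
        10 * scaledMoment 1 z + 4 * (z⁻¹ * scaledMoment 3 z) - 5 * (z⁻¹ * scaledMoment 2 z)) /
      (1 + 4 * (z⁻¹ * scaledMoment 1 z) + 2 * (z⁻¹ * (z⁻¹ * scaledMoment 2 z))) := by
  have h0 := coshMoment_zero_pos hz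
  have h1 := coshMoment_nonneg 1 z
  have h2 := coshMoment_nonneg 2 z
  have hrec := coshMoment_recurrence hz 0
  have hK : 0 < coshMoment 0 z + 4 * coshMoment 1 z + 2 * coshMoment 2 z := by linarith
  have hden : 1 + 4 * (z⁻¹ * scaledMoment 1 z) + 2 * (z⁻¹ * (z⁻¹ * scaledMoment 2 z)) =
      (coshMoment 0 z + 4 * coshMoment 1 z + 2 * coshMoment 2 z) / coshMoment 0 z := by
    unfold scaledMoment
    field_simp
  rw [hden, aOne, Kb_two_eq hz, Kb_three_eq hz]
  unfold scaledMoment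
  norm_num at hrec
  generalize coshMoment 0 z = x at *
  generalize coshMoment 1 z = y at *
  generalize coshMoment 2 z = u at *
  generalize coshMoment 3 z = v at *
  have hK' := hK.ne'
  field_simp
  linear_combination 5 * hrec

/-- The large-`z` expansion `aOne z = 1 + (5/2) z⁻¹ + (15/8) z⁻² + o(z⁻²)`. -/
lemma tendsto_aOne_expansion :
    Tendsto (fun z => z ^ 2 * (aOne z - 1 - 5 / 2 * z⁻¹)) atTop (nhds (15 / 8)) := by
  have m1 := tendsto_scaledMoment_one
  have m2 := tendsto_scaledMoment_two
  have e1 := tendsto_inv_mul_scaledMoment 1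
  have e2 := tendsto_inv_mul_scaledMoment 2
  have e3 := tendsto_inv_mul_scaledMoment 3
  have hnum := (((((m1.sub m2).const_mul (5 / 2)).add (m2.const_mul 10)).sub
    (m1.const_mul 10)).add (e3.const_mul 4)).sub (e2.const_mul 5)
  have hden := ((e1.const_mul 4).const_add 1).add
    ((tendsto_inv_atTop_zero.mul e2).const_mul 2)
  have h := hnum.div hden (by norm_num)
  norm_num at h
  refine (Tendsto.congr' ?_ h)
  filter_upwards [eventually_gt_atTop 0] with z hz
  rw [aOne_eq hz]
  norm_num

/-- The non-relativistic limit: (za₂(z) − a₁(z))/(za₃(z)) → 5/3 as z → ∞. -/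
theorem sound_speed_nonrelativistic_limit :
    Tendsto (fun z : ℝ => (z * aTwo z - aOne z) / (z * aThree z)) atTop
      (nhds (5 / 3)) := by
  have hw : Tendsto (fun z : ℝ => z⁻¹) atTop (nhds 0) := tendsto_inv_atTop_zero
  have hp := hw.prodMk_nhds tendsto_aOne_expansion
  have hcont : ContinuousAt (fun p : ℝ × ℝ => (25 / 4 - 2 * p.2 - p.2 ^ 2 * p.1 ^ 2) /
      (21 / 4 - 2 * p.2 + p.1 * (55 / 8 - 3 * p.2) + p.1 ^ 2 * (21 / 4 * p.2 - 3 * p.2 ^ 2) -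
        p.1 ^ 3 * (3 / 2 * p.2 ^ 2) - p.1 ^ 4 * p.2 ^ 3)) (0, 15 / 8) := by
    refine ContinuousAt.div (by fun_prop) (by fun_prop) (by norm_num)
  have h := hcont.tendsto.comp hp
  norm_num at h
  refine h.congr' ?_
  filter_upwards [eventually_gt_atTop 0] with z hz
  obtain ⟨e, he⟩ : ∃ e, e = z ^ 2 * (aOne z - 1 - 5 / 2 * z⁻¹) := ⟨_, rfl⟩
  have ha : aOne z = 1 + 5 / 2 * z⁻¹ + e * z⁻¹ ^ 2 := by
    rw [he]
    field_simp
    ring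
  have hnum : z * aTwo z - aOne z = z⁻¹ * (25 / 4 - 2 * e - e ^ 2 * z⁻¹ ^ 2) := by
    rw [aTwo, ha]
    field_simp
    ring
  have hden : z * aThree z = z⁻¹ * (21 / 4 - 2 * e + z⁻¹ * (55 / 8 - 3 * e) +
      z⁻¹ ^ 2 * (21 / 4 * e - 3 * e ^ 2) - z⁻¹ ^ 3 * (3 / 2 * e ^ 2) - z⁻¹ ^ 4 * e ^ 3) := by
    rw [aThree, ha]
    field_simp
    ring
  rw [hnum, hden, mul_div_mul_left _ _ (inv_ne_zero hz.ne')]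
  simp [he]
end

section
/- Let 𝔠 > 0, γ > 0, and let a ≥ 0, b ≥ 0, ς ∈ ℝ satisfy 0 < b + |ς| < 1/2 and 3|ς| + a + 2b < 2; set η := 1 − (3|ς| + a + 2b)/2 ∈ (0,1]. Define for p, q ∈ ℝ³ with p ≠ q the kernel k̄(p,q) := (𝔠+|q|)^{(3|ς|+a+2b)/2} · e^{−γ|p−q|} / ( (|p×q|² + 𝔠²|p−q|²)^{1/2} · |p−q|^{b+|ς|} ), and the weight w_{−ϱ,α}(p) := |p₁|^{−ϱ}(𝔠²+|p|²)^{α/2} if |p₁| < 1 and (𝔠²+|p|²)^{α/2} if |p₁| ≥ 1. Then for every ϱ with 0 < ϱ < 1 and every α with 0 ≤ α ≤ η there exists a constant C > 0 such that for all q ∈ ℝ³: ∫_{ℝ³} k̄(p,q) · w_{−ϱ,α}(p) dp ≤ C. -/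
open MeasureTheory

/-- The Euclidean norm on ℝ³. -/
noncomputable def norm3 (p : Fin 3 → ℝ) : ℝ := Real.sqrt (p 0 ^ 2 + p 1 ^ 2 + p 2 ^ 2)

/-- The cross product on ℝ³. -/
def cross3 (p q : Fin 3 → ℝ) : Fin 3 → ℝ :=
  ![p 1 * q 2 - p 2 * q 1, p 2 * q 0 - p 0 * q 2, p 0 * q 1 - p 1 * q 0]

/-- The kernel upper bound
k̄(p,q) = (c+|q|)^{(3|ς|+a+2b)/2} e^{−γ|p−q|} / ((|p×q|²+c²|p−q|²)^{1/2}|p−q|^{b+|ς|}). -/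
noncomputable def kbar (c γ a b ς : ℝ) (p q : Fin 3 → ℝ) : ℝ :=
  (c + norm3 q) ^ ((3 * |ς| + a + 2 * b) / 2) * Real.exp (-γ * norm3 (p - q)) /
    ((norm3 (cross3 p q) ^ 2 + c ^ 2 * norm3 (p - q) ^ 2) ^ ((1 : ℝ) / 2) *
      norm3 (p - q) ^ (b + |ς|))

/-- The singular weight w_{−ϱ,α}(p). -/
noncomputable def wgt (c ϱ α : ℝ) (p : Fin 3 → ℝ) : ℝ :=
  if |p 0| < 1 then |p 0| ^ (-ϱ) * (c ^ 2 + norm3 p ^ 2) ^ (α / 2)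
  else (c ^ 2 + norm3 p ^ 2) ^ (α / 2)

open scoped ENNReal

/-- The one-dimensional singular majorant `1 + |x|^{-μ}`, infinite at the origin if `μ > 0`. -/
noncomputable def singMaj (μ x : ℝ) : ℝ≥0∞ := 1 + ‖x‖ₑ ^ (-μ)

/-- The one-dimensional exponential damping factor `e^{-δ|x|}`. -/
noncomputable def expDamp (δ x : ℝ) : ℝ≥0∞ := ENNReal.ofReal (Real.exp (-δ * |x|))

@[fun_prop]
lemma measurable_singMaj (μ : ℝ) : Measurable (singMaj μ) := by
  unfold singMaj; fun_prop

@[fun_prop]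
lemma measurable_expDamp (δ : ℝ) : Measurable (expDamp δ) := by
  unfold expDamp; fun_prop

lemma expDamp_ne_zero (δ x : ℝ) : expDamp δ x ≠ 0 := by
  simp [expDamp, Real.exp_pos]

lemma singMaj_ne_zero (μ x : ℝ) : singMaj μ x ≠ 0 := by
  simp [singMaj]

lemma singMaj_zero {μ : ℝ} (hμ : 0 < μ) : singMaj μ 0 = ∞ := by
  simp [singMaj, hμ]

lemma singMaj_of_ne_zero (μ : ℝ) {x : ℝ} (hx : x ≠ 0) :
    singMaj μ x = ENNReal.ofReal (1 + |x| ^ (-μ)) := by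
  rw [singMaj, Real.enorm_eq_ofReal_abs, ENNReal.ofReal_rpow_of_pos (abs_pos.2 hx),
    ENNReal.ofReal_add zero_le_one (by positivity), ENNReal.ofReal_one]

lemma lintegral_expDamp_lt_top {δ : ℝ} (hδ : 0 < δ) : ∫⁻ x, expDamp δ x < ∞ := by
  have hint : Integrable (fun x : ℝ => Real.exp (-δ * |x|)) := by
    by_contra h
    have h0 := integral_undef h
    rw [integral_comp_abs (f := fun x => Real.exp (-δ * x)),
      integral_exp_mul_Ioi (by linarith) 0] at h0
    simp [hδ.ne'] at h0
  exact hint.lintegral_lt_top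

lemma setLIntegral_enorm_rpow_lt_top {μ : ℝ} (hμ : μ < 1) :
    ∫⁻ x in Metric.ball (0 : ℝ) 1, ‖x‖ₑ ^ (-μ) < ∞ := by
  have hint : IntegrableOn (fun x : ℝ => |x| ^ (-μ)) (Metric.ball 0 1) := by
    refine integrableOn_ball_of_norm_le_rpow (C := 1) (α := μ) (by simp) (by simpa using hμ)
      (Filter.Eventually.of_forall fun x => ?_)
      (Measurable.aestronglyMeasurable (by fun_prop))
    rw [Real.norm_of_nonneg (by positivity), one_mul, Real.norm_eq_abs]
  refine lt_of_eq_of_lt (lintegral_congr_ae (ae_restrict_of_ae ?_)) hint.lintegral_lt_top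
  filter_upwards [Measure.ae_ne volume (0 : ℝ)] with x hx
  rw [Real.enorm_eq_ofReal_abs, ENNReal.ofReal_rpow_of_pos (abs_pos.2 hx)]

/-- The damped integrals of all translates of the singular majorant are uniformly bounded. -/
lemma exists_lintegral_expDamp_mul_singMaj_le {δ μ : ℝ} (hδ : 0 < δ) (hμ0 : 0 < μ) (hμ : μ < 1) :
    ∃ M : ℝ≥0∞, M < ∞ ∧ ∀ s, ∫⁻ x, expDamp δ x * singMaj μ (x + s) ≤ M := by
  refine ⟨2 * (∫⁻ x, expDamp δ x) + ∫⁻ x in Metric.ball (0 : ℝ) 1, ‖x‖ₑ ^ (-μ),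
    ENNReal.add_lt_top.2 ⟨ENNReal.mul_lt_top (by simp) (lintegral_expDamp_lt_top hδ),
      setLIntegral_enorm_rpow_lt_top hμ⟩, fun s => ?_⟩
  set g : ℝ → ℝ≥0∞ := (Metric.ball (0 : ℝ) 1).indicator (fun x => ‖x‖ₑ ^ (-μ)) with hg
  have hgm : Measurable g := Measurable.indicator (by fun_prop) measurableSet_ball
  have hle (x : ℝ) : expDamp δ x * singMaj μ (x + s) ≤ 2 * expDamp δ x + g (x + s) := by
    have hE : expDamp δ x ≤ 1 := by
      simp only [expDamp, ENNReal.ofReal_le_one, Real.exp_le_one_iff]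
      nlinarith [abs_nonneg x]
    by_cases hx : x + s ∈ Metric.ball (0 : ℝ) 1
    · rw [hg, Set.indicator_of_mem hx, singMaj, mul_add, mul_one]
      refine add_le_add (le_mul_of_one_le_left' one_le_two) (mul_le_of_le_one_left' hE)
    · rw [hg, Set.indicator_of_notMem hx, add_zero, mul_comm]
      have h1 : (1 : ℝ≥0∞) ≤ ‖x + s‖ₑ := by
        rw [Real.enorm_eq_ofReal_abs]
        simpa using hx
      gcongr
      calc singMaj μ (x + s) ≤ 1 + 1 := by
            unfold singMaj
            gcongr
            rw [ENNReal.rpow_neg, ENNReal.inv_le_one]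
            exact ENNReal.one_le_rpow h1 hμ0
        _ = 2 := one_add_one_eq_two
  calc ∫⁻ x, expDamp δ x * singMaj μ (x + s) ≤ ∫⁻ x, (2 * expDamp δ x + g (x + s)) :=
        lintegral_mono hle
    _ = 2 * (∫⁻ x, expDamp δ x) + ∫⁻ x, g (x + s) := by
        rw [lintegral_add_left (by fun_prop), lintegral_const_mul _ (by fun_prop)]
    _ = _ := by
        rw [lintegral_add_right_eq_self, hg, lintegral_indicator measurableSet_ball]

/-- An integral over `ℝ³` of a product which, once the `i`-th coordinate is fixed, splits into
functions of the two other coordinates, is bounded by slice-wise bounds. -/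
lemma lintegral_fin_three_le_of_slices (i : Fin 3) {f : ℝ → ℝ≥0∞} {g h : ℝ → ℝ → ℝ≥0∞}
    (hf : Measurable f) (hg : Measurable (Function.uncurry g))
    (hh : Measurable (Function.uncurry h)) {A B D : ℝ≥0∞} (hA : ∫⁻ x, f x ≤ A)
    (hB : ∀ x, ∫⁻ y, g x y ≤ B) (hD : ∀ x, ∫⁻ y, h x y ≤ D) :
    ∫⁻ z : Fin 3 → ℝ, f (z i) * (g (z i) (z (i.succAbove 0)) * h (z i) (z (i.succAbove 1)))
      ≤ A * (B * D) := by
  have hg' (x : ℝ) : Measurable (g x) := hg.of_uncurry_left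
  have hh' (x : ℝ) : Measurable (h x) := hh.of_uncurry_left
  have e1 := (volume_preserving_piFinSuccAbove (fun _ : Fin 3 => ℝ) i).lintegral_comp_emb
    (MeasurableEquiv.measurableEmbedding _)
    (fun w => f w.1 * (g w.1 (w.2 0) * h w.1 (w.2 1)))
  have e2 (x : ℝ) := (volume_preserving_finTwoArrow ℝ).lintegral_comp_emb
    (MeasurableEquiv.measurableEmbedding _) (fun w => g x w.1 * h x w.2)
  have hslice (x : ℝ) : ∫⁻ w : Fin 2 → ℝ, g x (w 0) * h x (w 1) ≤ B * D := by
    refine (e2 x).trans_le ?_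
    rw [Measure.volume_eq_prod, lintegral_prod_mul (hg' x).aemeasurable (hh' x).aemeasurable]
    exact mul_le_mul' (hB x) (hD x)
  refine e1.trans_le ?_
  rw [Measure.volume_eq_prod]
  refine (lintegral_prod_le _).trans ?_
  calc ∫⁻ x, ∫⁻ w : Fin 2 → ℝ, f x * (g x (w 0) * h x (w 1))
      = ∫⁻ x, f x * ∫⁻ w : Fin 2 → ℝ, g x (w 0) * h x (w 1) := by
        refine lintegral_congr fun x => lintegral_const_mul _ ?_
        exact ((hg' x).comp (measurable_pi_apply 0)).mul ((hh' x).comp (measurable_pi_apply 1))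
    _ ≤ ∫⁻ x, f x * (B * D) := by gcongr; exact hslice _
    _ = (∫⁻ x, f x) * (B * D) := lintegral_mul_const _ hf
    _ ≤ A * (B * D) := by gcongr

lemma norm3_eq_norm (p : Fin 3 → ℝ) : norm3 p = ‖WithLp.toLp 2 p‖ := by
  simp [norm3, EuclideanSpace.norm_eq, Fin.sum_univ_three]

lemma norm3_nonneg (p : Fin 3 → ℝ) : 0 ≤ norm3 p := Real.sqrt_nonneg _

lemma norm3_sq (p : Fin 3 → ℝ) : norm3 p ^ 2 = p 0 ^ 2 + p 1 ^ 2 + p 2 ^ 2 :=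
  Real.sq_sqrt (by positivity)

lemma norm3_add_le (p q : Fin 3 → ℝ) : norm3 (p + q) ≤ norm3 p + norm3 q := by
  simpa only [norm3_eq_norm, WithLp.toLp_add] using norm_add_le _ _

lemma abs_apply_le_norm3 (p : Fin 3 → ℝ) (i : Fin 3) : |p i| ≤ norm3 p := by
  rw [norm3_eq_norm]
  exact PiLp.norm_apply_le (WithLp.toLp 2 p) i

/-- The numerator of the weighted kernel grows at most linearly in `|q|`, up to a factor absorbed
by the exponential. -/
lemma rpow_mul_exp_mul_rpow_le {c γ s α : ℝ} (hc : 0 < c) (hγ : 0 < γ) (hα : 0 ≤ α)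
    (hs : 0 ≤ s) (hsα : s + α ≤ 1) (z q : Fin 3 → ℝ) :
    (c + norm3 q) ^ s * Real.exp (-γ * norm3 z) * (c ^ 2 + norm3 (z + q) ^ 2) ^ (α / 2) ≤
      c ^ (s + α - 1) * (1 + 2 / (c * γ)) * (c + norm3 q) *
        (Real.exp (-(γ / 6) * |z 0|) * Real.exp (-(γ / 6) * |z 1|) *
          Real.exp (-(γ / 6) * |z 2|)) := by
  have hn := norm3_nonneg q
  have hN := norm3_nonneg z
  have hP := norm3_nonneg (z + q)
  have hcn : 0 < c + norm3 q := by positivity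
  have h1 : (c ^ 2 + norm3 (z + q) ^ 2) ^ (α / 2) ≤ (c + norm3 q) ^ α * (1 + norm3 z / c) := by
    calc (c ^ 2 + norm3 (z + q) ^ 2) ^ (α / 2) ≤ ((c + norm3 (z + q)) ^ 2) ^ (α / 2) := by
          gcongr
          nlinarith [mul_nonneg hc.le hP]
      _ = (c + norm3 (z + q)) ^ α := by
          rw [← Real.rpow_natCast, ← Real.rpow_mul (by positivity)]
          congr 1
          push_cast
          ring
      _ ≤ ((c + norm3 q) * (1 + norm3 z / c)) ^ α := by
          have h := norm3_add_le z q
          have h' : (c + norm3 q) * (1 + norm3 z / c) =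
              c + norm3 q + norm3 z + norm3 q * norm3 z / c := by
            field_simp
            ring
          have h'' : 0 ≤ norm3 q * norm3 z / c := by positivity
          gcongr
          linarith
      _ = (c + norm3 q) ^ α * (1 + norm3 z / c) ^ α :=
          Real.mul_rpow hcn.le (by positivity)
      _ ≤ (c + norm3 q) ^ α * (1 + norm3 z / c) := by
          gcongr
          refine Real.rpow_le_self_of_one_le ?_ (by linarith)
          have : 0 ≤ norm3 z / c := by positivity
          linarith
  have h2 : (c + norm3 q) ^ s * (c + norm3 q) ^ α ≤ c ^ (s + α - 1) * (c + norm3 q) := by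
    rw [← Real.rpow_add hcn]
    calc (c + norm3 q) ^ (s + α) = (c + norm3 q) ^ (s + α - 1) * (c + norm3 q) := by
          rw [← Real.rpow_add_one hcn.ne']
          congr 1
          ring
      _ ≤ c ^ (s + α - 1) * (c + norm3 q) := by
          refine mul_le_mul_of_nonneg_right ?_ hcn.le
          exact Real.rpow_le_rpow_of_nonpos hc (le_add_of_nonneg_right hn) (by linarith)
  have h3 : Real.exp (-γ * norm3 z) * (1 + norm3 z / c) ≤
      (1 + 2 / (c * γ)) * Real.exp (-(γ / 2) * norm3 z) := by
    have h : 1 + norm3 z / c ≤ (1 + 2 / (c * γ)) * Real.exp (γ / 2 * norm3 z) := by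
      calc 1 + norm3 z / c ≤ 1 + norm3 z / c + (γ / 2 * norm3 z + 2 / (c * γ)) :=
            le_add_of_nonneg_right (by positivity)
        _ = (1 + 2 / (c * γ)) * (γ / 2 * norm3 z + 1) := by
            field_simp
            ring
        _ ≤ _ := by
            gcongr
            exact Real.add_one_le_exp _
    calc Real.exp (-γ * norm3 z) * (1 + norm3 z / c)
        ≤ Real.exp (-γ * norm3 z) * ((1 + 2 / (c * γ)) * Real.exp (γ / 2 * norm3 z)) := by
          gcongr
      _ = (1 + 2 / (c * γ)) * Real.exp (-(γ / 2) * norm3 z) := by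
          rw [mul_left_comm, ← Real.exp_add]
          ring_nf
  have h4 : Real.exp (-(γ / 2) * norm3 z) ≤ Real.exp (-(γ / 6) * |z 0|) *
      Real.exp (-(γ / 6) * |z 1|) * Real.exp (-(γ / 6) * |z 2|) := by
    rw [← Real.exp_add, ← Real.exp_add, Real.exp_le_exp]
    nlinarith [abs_apply_le_norm3 z 0, abs_apply_le_norm3 z 1, abs_apply_le_norm3 z 2]
  calc _ ≤ (c + norm3 q) ^ s * Real.exp (-γ * norm3 z) *
          ((c + norm3 q) ^ α * (1 + norm3 z / c)) := by gcongr
    _ = ((c + norm3 q) ^ s * (c + norm3 q) ^ α) *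
          (Real.exp (-γ * norm3 z) * (1 + norm3 z / c)) := by ring
    _ ≤ (c ^ (s + α - 1) * (c + norm3 q)) *
          ((1 + 2 / (c * γ)) * (Real.exp (-(γ / 6) * |z 0|) *
            Real.exp (-(γ / 6) * |z 1|) * Real.exp (-(γ / 6) * |z 2|))) := by
        have h3' := h3.trans (mul_le_mul_of_nonneg_left h4 (by positivity))
        gcongr
    _ = _ := by ring

lemma sq_mul_shear_le {c n N x y w Q u v : ℝ} (hn : n ^ 2 = Q ^ 2 + u ^ 2 + v ^ 2)
    (hN : N ^ 2 = x ^ 2 + y ^ 2 + w ^ 2) (hu : |u| ≤ |Q|) (hv : |v| ≤ |Q|) :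
    (c + n) ^ 2 * ((y - u / Q * x) ^ 2 + (w - v / Q * x) ^ 2) ≤
      9 * ((y * Q - x * u) ^ 2 + (w * Q - x * v) ^ 2 + c ^ 2 * N ^ 2) := by
  have shear {t a : ℝ} (ht : |t| ≤ |Q|) :
      Q ^ 2 * (a - t / Q * x) ^ 2 = (a * Q - x * t) ^ 2 ∧
        (a - t / Q * x) ^ 2 ≤ 2 * a ^ 2 + 2 * x ^ 2 := by
    have hm : t = t / Q * Q := by
      rcases eq_or_ne Q 0 with rfl | hQ
      · simpa using ht
      · field_simp
    have hm1 : |t / Q| ≤ 1 := by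
      rw [abs_div]
      exact div_le_one_of_le₀ ht (abs_nonneg _)
    set m := t / Q
    have hm2 : m ^ 2 ≤ 1 := (sq_le_one_iff_abs_le_one m).2 hm1
    refine ⟨by rw [hm]; ring, ?_⟩
    nlinarith [sq_nonneg (a + m * x), mul_le_mul_of_nonneg_right hm2 (sq_nonneg x)]
  obtain ⟨hA, hA'⟩ := shear (a := y) hu
  obtain ⟨hB, hB'⟩ := shear (a := w) hv
  rw [← hA, ← hB, hN]
  set A := y - u / Q * x
  set B := w - v / Q * x
  have h1 : (c + n) ^ 2 ≤ 2 * c ^ 2 + 6 * Q ^ 2 := by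
    nlinarith [sq_nonneg (c - n), sq_le_sq.2 hu, sq_le_sq.2 hv]
  calc (c + n) ^ 2 * (A ^ 2 + B ^ 2) ≤ (2 * c ^ 2 + 6 * Q ^ 2) * (A ^ 2 + B ^ 2) := by gcongr
    _ ≤ _ := by
      nlinarith [mul_nonneg (sq_nonneg c) (sq_nonneg y), mul_nonneg (sq_nonneg c) (sq_nonneg w),
        mul_nonneg (sq_nonneg c) (sq_nonneg x), mul_nonneg (sq_nonneg Q) (sq_nonneg A),
        mul_nonneg (sq_nonneg Q) (sq_nonneg B), mul_le_mul_of_nonneg_left hA' (sq_nonneg c),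
        mul_le_mul_of_nonneg_left hB' (sq_nonneg c)]

/-- Coercivity of the denominator of the kernel in the two coordinates transversal to `q`, sheared
along a dominant coordinate of `q`. -/
lemma mul_sqrt_shear_le {c : ℝ} (hc : 0 < c) (z q : Fin 3 → ℝ) {i : Fin 3}
    (hi : ∀ j, |q j| ≤ |q i|) :
    (c + norm3 q) * Real.sqrt
        ((z (i.succAbove 0) - q (i.succAbove 0) / q i * z i) ^ 2 +
          (z (i.succAbove 1) - q (i.succAbove 1) / q i * z i) ^ 2) ≤
      3 * (norm3 (cross3 (z + q) q) ^ 2 + c ^ 2 * norm3 z ^ 2) ^ ((1 : ℝ) / 2) := by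
  have hn := norm3_nonneg q
  rw [← Real.sqrt_eq_rpow]
  refine abs_le_of_sq_le_sq' ?_ (by positivity) |>.2
  rw [mul_pow, mul_pow, Real.sq_sqrt (by positivity), Real.sq_sqrt (by positivity)]
  have h := sq_mul_shear_le (c := c) (n := norm3 q) (N := norm3 z) (x := z i) (Q := q i)
    (y := z (i.succAbove 0)) (w := z (i.succAbove 1)) (u := q (i.succAbove 0))
    (v := q (i.succAbove 1))
    (by rw [norm3_sq]; fin_cases i <;> simp [Fin.succAbove] <;> ring)
    (by rw [norm3_sq]; fin_cases i <;> simp [Fin.succAbove] <;> ring) (hi _) (hi _)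
  refine h.trans ?_
  rw [norm3_sq (cross3 _ _)]
  have hcross : (z (i.succAbove 0) * q i - z i * q (i.succAbove 0)) ^ 2 +
      (z (i.succAbove 1) * q i - z i * q (i.succAbove 1)) ^ 2 ≤
      cross3 (z + q) q 0 ^ 2 + cross3 (z + q) q 1 ^ 2 + cross3 (z + q) q 2 ^ 2 := by
    have h0 := sq_nonneg (z 1 * q 2 - z 2 * q 1)
    have h1 := sq_nonneg (z 2 * q 0 - z 0 * q 2)
    have h2 := sq_nonneg (z 0 * q 1 - z 1 * q 0)
    fin_cases i <;> simp [Fin.succAbove, cross3] <;> nlinarith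
  linarith

lemma inv_sqrt_le_rpow_mul_rpow {A B θ : ℝ} (hA : A ≠ 0) (hB : B ≠ 0) (hθ0 : 0 ≤ θ)
    (hθ1 : θ ≤ 1) :
    (Real.sqrt (A ^ 2 + B ^ 2))⁻¹ ≤ |A| ^ (-θ) * |B| ^ (-(1 - θ)) := by
  have hA' := abs_pos.2 hA
  have hB' := abs_pos.2 hB
  have h1 : |A| ≤ Real.sqrt (A ^ 2 + B ^ 2) := Real.abs_le_sqrt (by nlinarith)
  have h2 : |B| ≤ Real.sqrt (A ^ 2 + B ^ 2) := Real.abs_le_sqrt (by nlinarith)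
  set r := Real.sqrt (A ^ 2 + B ^ 2)
  have hr : 0 < r := hA'.trans_le h1
  calc r⁻¹ = r ^ (-θ) * r ^ (-(1 - θ)) := by
        rw [← Real.rpow_add hr, ← Real.rpow_neg_one]
        congr 1
        ring
    _ ≤ _ := mul_le_mul (Real.rpow_le_rpow_of_nonpos hA' h1 (by linarith))
        (Real.rpow_le_rpow_of_nonpos hB' h2 (by linarith)) (by positivity) (by positivity)

lemma wgt_le {c : ℝ} (ϱ α : ℝ) (p : Fin 3 → ℝ) :
    wgt c ϱ α p ≤ (1 + |p 0| ^ (-ϱ)) * (c ^ 2 + norm3 p ^ 2) ^ (α / 2) := by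
  have h1 : 0 ≤ (c ^ 2 + norm3 p ^ 2) ^ (α / 2) := by positivity
  have h2 : 0 ≤ |p 0| ^ (-ϱ) := by positivity
  unfold wgt
  split_ifs <;> nlinarith [mul_nonneg h1 h2]

lemma kbar_mul_wgt_le {c γ a b ς ϱ α θ : ℝ} (hc : 0 < c) (hγ : 0 < γ) (ha : 0 ≤ a) (hb : 0 ≤ b)
    (hα : 0 ≤ α) (hsα : (3 * |ς| + a + 2 * b) / 2 + α ≤ 1) (hθ0 : 0 ≤ θ) (hθ1 : θ ≤ 1)
    (z q : Fin 3 → ℝ) {i l : Fin 3} (hi : ∀ j, |q j| ≤ |q i|) (hl : z l ≠ 0)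
    (hA : z (i.succAbove 0) - q (i.succAbove 0) / q i * z i ≠ 0)
    (hB : z (i.succAbove 1) - q (i.succAbove 1) / q i * z i ≠ 0) :
    kbar c γ a b ς (z + q) q * wgt c ϱ α (z + q) ≤
      3 * (c ^ ((3 * |ς| + a + 2 * b) / 2 + α - 1) * (1 + 2 / (c * γ))) *
        (Real.exp (-(γ / 6) * |z 0|) * Real.exp (-(γ / 6) * |z 1|) *
          Real.exp (-(γ / 6) * |z 2|)) *
        ((1 + |z 0 + q 0| ^ (-ϱ)) * |z l| ^ (-(b + |ς|)) *
          (|z (i.succAbove 0) - q (i.succAbove 0) / q i * z i| ^ (-θ) *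
            |z (i.succAbove 1) - q (i.succAbove 1) / q i * z i| ^ (-(1 - θ)))) := by
  have hς := abs_nonneg ς
  set s := (3 * |ς| + a + 2 * b) / 2
  set β := b + |ς|
  set E := Real.exp (-(γ / 6) * |z 0|) * Real.exp (-(γ / 6) * |z 1|) *
    Real.exp (-(γ / 6) * |z 2|) with hE
  set K := c ^ (s + α - 1) * (1 + 2 / (c * γ)) with hK
  have hnum := rpow_mul_exp_mul_rpow_le hc hγ hα (by positivity : 0 ≤ s) hsα z q
  rw [← hE, ← hK] at hnum
  have hden := mul_sqrt_shear_le hc z q hi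
  have hS := inv_sqrt_le_rpow_mul_rpow hA hB hθ0 hθ1
  set A := z (i.succAbove 0) - q (i.succAbove 0) / q i * z i
  set B := z (i.succAbove 1) - q (i.succAbove 1) / q i * z i
  set S := Real.sqrt (A ^ 2 + B ^ 2)
  have hSpos : 0 < S := Real.sqrt_pos.2 (by positivity)
  set D := (norm3 (cross3 (z + q) q) ^ 2 + c ^ 2 * norm3 z ^ 2) ^ ((1 : ℝ) / 2) with hD
  have hcn : 0 < c + norm3 q := add_pos_of_pos_of_nonneg hc (norm3_nonneg q)
  have hDpos : 0 < D := by nlinarith [mul_pos hcn hSpos]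
  have hlpos := abs_pos.2 hl
  have hNpos : 0 < norm3 z := hlpos.trans_le (abs_apply_le_norm3 z l)
  have hNβ : (norm3 z ^ β)⁻¹ ≤ |z l| ^ (-β) := by
    rw [← Real.rpow_neg hNpos.le]
    exact Real.rpow_le_rpow_of_nonpos hlpos (abs_apply_le_norm3 z l)
      (neg_nonpos.2 (by positivity))
  have hratio : (c + norm3 q) * D⁻¹ ≤ 3 * S⁻¹ := by
    rw [← div_eq_mul_inv, ← div_eq_mul_inv, div_le_div_iff₀ hDpos hSpos]
    exact hden
  have hk : kbar c γ a b ς (z + q) q =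
      (c + norm3 q) ^ s * Real.exp (-γ * norm3 z) * D⁻¹ * (norm3 z ^ β)⁻¹ := by
    simp only [kbar, add_sub_cancel_right]
    rw [div_eq_mul_inv, mul_inv, ← hD, mul_assoc _ D⁻¹]
  have hkn : 0 ≤ kbar c γ a b ς (z + q) q := by
    rw [hk]
    positivity
  have hK0 : 0 ≤ K := by positivity
  have hE0 : 0 ≤ E := by positivity
  have hW0 : 0 ≤ 1 + |z 0 + q 0| ^ (-ϱ) := by positivity
  calc kbar c γ a b ς (z + q) q * wgt c ϱ α (z + q)
      ≤ kbar c γ a b ς (z + q) q *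
          ((1 + |z 0 + q 0| ^ (-ϱ)) * (c ^ 2 + norm3 (z + q) ^ 2) ^ (α / 2)) :=
        mul_le_mul_of_nonneg_left (wgt_le ϱ α (z + q)) hkn
    _ = ((c + norm3 q) ^ s * Real.exp (-γ * norm3 z) *
          (c ^ 2 + norm3 (z + q) ^ 2) ^ (α / 2)) *
          (D⁻¹ * ((1 + |z 0 + q 0| ^ (-ϱ)) * (norm3 z ^ β)⁻¹)) := by
        rw [hk]
        ring
    _ ≤ (K * (c + norm3 q) * E) * (D⁻¹ * ((1 + |z 0 + q 0| ^ (-ϱ)) * |z l| ^ (-β))) := by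
        gcongr
    _ = K * E * ((1 + |z 0 + q 0| ^ (-ϱ)) * |z l| ^ (-β)) * ((c + norm3 q) * D⁻¹) := by ring
    _ ≤ K * E * ((1 + |z 0 + q 0| ^ (-ϱ)) * |z l| ^ (-β)) *
          (3 * (|A| ^ (-θ) * |B| ^ (-(1 - θ)))) := by
        have := hratio.trans (mul_le_mul_of_nonneg_left hS (by norm_num))
        gcongr
    _ = _ := by ring

lemma abs_rpow_neg_le {x κ μ : ℝ} (hx : x ≠ 0) (hκ : 0 ≤ κ) (hκμ : κ ≤ μ) :
    |x| ^ (-κ) ≤ 1 + |x| ^ (-μ) := by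
  have hx' := abs_pos.2 hx
  rcases le_total |x| 1 with h | h
  · have := Real.rpow_le_rpow_of_exponent_ge hx' h (neg_le_neg hκμ)
    linarith
  · have := Real.rpow_le_one_of_one_le_of_nonpos h (neg_nonpos.2 hκ)
    have : 0 ≤ |x| ^ (-μ) := by positivity
    linarith

lemma abs_rpow_neg_mul_le {x y κ κ' μ : ℝ} (hx : x ≠ 0) (hy : y ≠ 0) (hκ : 0 ≤ κ) (hκ' : 0 ≤ κ')
    (h : κ + κ' ≤ μ) :
    |x| ^ (-κ) * |y| ^ (-κ') ≤ (1 + |x| ^ (-μ)) + (1 + |y| ^ (-μ)) := by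
  wlog hxy : |x| ≤ |y| generalizing x y κ κ'
  · rw [mul_comm, add_comm]
    exact this hy hx hκ' hκ (by linarith) (le_of_not_ge hxy)
  have hx' := abs_pos.2 hx
  have hy' : 0 ≤ |y| ^ (-μ) := by positivity
  calc |x| ^ (-κ) * |y| ^ (-κ') ≤ |x| ^ (-κ) * |x| ^ (-κ') := by
        gcongr ?_ * ?_
        exact Real.rpow_le_rpow_of_nonpos hx' hxy (neg_nonpos.2 hκ')
    _ = |x| ^ (-(κ + κ')) := by
        rw [← Real.rpow_add hx']
        congr 1
        ring
    _ ≤ 1 + |x| ^ (-μ) := abs_rpow_neg_le hx (by positivity) h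
    _ ≤ _ := by linarith

lemma one_add_abs_rpow_neg_mul_le {x y κ κ' μ : ℝ} (hx : x ≠ 0) (hy : y ≠ 0) (hκ : 0 ≤ κ)
    (hκ' : 0 ≤ κ') (h : κ + κ' ≤ μ) :
    (1 + |x| ^ (-κ)) * |y| ^ (-κ') ≤ 2 * ((1 + |x| ^ (-μ)) + (1 + |y| ^ (-μ))) := by
  have h1 := abs_rpow_neg_mul_le hx hy hκ hκ' h
  have h2 := abs_rpow_neg_mul_le hx hy le_rfl hκ' (by linarith : 0 + κ' ≤ μ)
  rw [neg_zero, Real.rpow_zero] at h2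
  linarith

/-- A real bound by singular factors, valid away from the singularities, holds everywhere in
`ℝ≥0∞`, since there the singular factors are infinite. -/
lemma ofReal_le_mul_singMaj {μ δ K F x y w t₁ t₂ t₃ t₄ : ℝ} (hμ : 0 < μ) (hK : 0 < K)
    (h : t₁ ≠ 0 → t₂ ≠ 0 → t₃ ≠ 0 → t₄ ≠ 0 →
      F ≤ K * (Real.exp (-δ * |x|) * Real.exp (-δ * |y|) * Real.exp (-δ * |w|)) *
        ((1 + |t₁| ^ (-μ)) * ((1 + |t₂| ^ (-μ)) + (1 + |t₃| ^ (-μ))) * (1 + |t₄| ^ (-μ)))) :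
    ENNReal.ofReal F ≤ ENNReal.ofReal K * (expDamp δ x * singMaj μ t₁ *
      (expDamp δ y * (singMaj μ t₂ + singMaj μ t₃) * (expDamp δ w * singMaj μ t₄))) := by
  by_cases h0 : t₁ = 0 ∨ t₂ = 0 ∨ t₃ = 0 ∨ t₄ = 0
  · refine le_top.trans_eq (Eq.symm ?_)
    rcases h0 with rfl | rfl | rfl | rfl <;>
      simp [singMaj_zero hμ, expDamp_ne_zero, singMaj_ne_zero, hK]
  · push Not at h0
    obtain ⟨h1, h2, h3, h4⟩ := h0
    rw [singMaj_of_ne_zero μ h1, singMaj_of_ne_zero μ h2, singMaj_of_ne_zero μ h3,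
      singMaj_of_ne_zero μ h4, ← ENNReal.ofReal_add (by positivity) (by positivity)]
    simp only [expDamp]
    repeat rw [← ENNReal.ofReal_mul (by positivity)]
    refine ENNReal.ofReal_le_ofReal ((h h1 h2 h3 h4).trans_eq ?_)
    ring

/-- Uniformly in `q`, the weighted kernel is dominated by a product of one-dimensional damped
singular factors in suitably sheared coordinates. -/
lemma exists_ofReal_kbar_mul_wgt_le {c γ a b ς ϱ α μ : ℝ} (hc : 0 < c) (hγ : 0 < γ) (ha : 0 ≤ a)
    (hb : 0 ≤ b) (hα : 0 ≤ α) (hsα : (3 * |ς| + a + 2 * b) / 2 + α ≤ 1) (hϱ0 : 0 < ϱ)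
    (hϱ1 : ϱ < 1) (hμ1 : (1 + ϱ) / 2 ≤ μ) (hμ2 : 1 / 2 + (b + |ς|) ≤ μ) :
    ∃ K : ℝ, ∀ q : Fin 3 → ℝ, ∃ (i : Fin 3) (s : ℝ) (u v w : ℝ → ℝ),
      Measurable u ∧ Measurable v ∧ Measurable w ∧ ∀ z : Fin 3 → ℝ,
        ENNReal.ofReal (kbar c γ a b ς (z + q) q * wgt c ϱ α (z + q)) ≤
          ENNReal.ofReal K * (expDamp (γ / 6) (z i) * singMaj μ (z i + s) *
            (expDamp (γ / 6) (z (i.succAbove 0)) *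
              (singMaj μ (z (i.succAbove 0) + u (z i)) +
                singMaj μ (z (i.succAbove 0) + v (z i))) *
              (expDamp (γ / 6) (z (i.succAbove 1)) *
                singMaj μ (z (i.succAbove 1) + w (z i))))) := by
  have hμ : 0 < μ := by linarith
  have hβ : 0 ≤ b + |ς| := by positivity
  set C := 3 * (c ^ ((3 * |ς| + a + 2 * b) / 2 + α - 1) * (1 + 2 / (c * γ)))
  have hC : 0 < C := by positivity
  refine ⟨C * 2, fun q => ?_⟩
  obtain ⟨i, hi⟩ := Finite.exists_max (fun j => |q j|)
  have hexp (z : Fin 3 → ℝ) : Real.exp (-(γ / 6) * |z 0|) * Real.exp (-(γ / 6) * |z 1|) *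
      Real.exp (-(γ / 6) * |z 2|) = Real.exp (-(γ / 6) * |z i|) *
        Real.exp (-(γ / 6) * |z (i.succAbove 0)|) *
        Real.exp (-(γ / 6) * |z (i.succAbove 1)|) := by
    fin_cases i <;> simp [Fin.succAbove] <;> ring
  rcases eq_or_ne i 0 with hi0 | hi0
  · refine ⟨i, q 0, fun x => -(q (i.succAbove 0) / q i * x), fun _ => 0,
      fun x => -(q (i.succAbove 1) / q i * x), by fun_prop, by fun_prop, by fun_prop, fun z => ?_⟩
    refine ofReal_le_mul_singMaj hμ (by positivity) fun h1 h2 h3 h4 => ?_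
    simp only [← sub_eq_add_neg] at h2 h4 ⊢
    rw [add_zero] at h3 ⊢
    have hk := kbar_mul_wgt_le (θ := 1 / 2) (ϱ := ϱ) hc hγ ha hb hα hsα (by norm_num)
      (by norm_num) z q hi h3 h2 h4
    refine hk.trans ?_
    rw [hexp z, mul_right_comm C 2, mul_assoc _ 2]
    refine mul_le_mul_of_nonneg_left ?_ (by positivity)
    have e0 : z i + q 0 = z 0 + q 0 := by rw [hi0]
    rw [e0] at h1 ⊢
    have b1 := abs_rpow_neg_le h1 hϱ0.le (by linarith : ϱ ≤ μ)
    have b2 := abs_rpow_neg_mul_le h2 h3 (by norm_num : (0 : ℝ) ≤ 1 / 2) hβ hμ2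
    have b3 := abs_rpow_neg_le h4 (by norm_num : (0 : ℝ) ≤ 1 - 1 / 2) (by linarith : _ ≤ μ)
    have b1' : 1 + |z 0 + q 0| ^ (-ϱ) ≤ 2 * (1 + |z 0 + q 0| ^ (-μ)) := by
      have : 0 ≤ |z 0 + q 0| ^ (-μ) := by positivity
      linarith
    have b12 := mul_le_mul b1' b2 (by positivity) (by positivity)
    have b123 := mul_le_mul b12 b3 (by positivity) (by positivity)
    refine (Eq.trans_le ?_ b123).trans_eq ?_ <;> ring
  · have hs0 : i.succAbove 0 = 0 := Fin.succAbove_ne_zero_zero hi0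
    refine ⟨i, 0, fun _ => q 0, fun x => -(q (i.succAbove 0) / q i * x),
      fun x => -(q (i.succAbove 1) / q i * x), by fun_prop, by fun_prop, by fun_prop, fun z => ?_⟩
    refine ofReal_le_mul_singMaj hμ (by positivity) fun h1 h2 h3 h4 => ?_
    simp only [← sub_eq_add_neg] at h3 h4 ⊢
    rw [add_zero] at h1 ⊢
    have hk := kbar_mul_wgt_le (θ := (1 - ϱ) / 2) (ϱ := ϱ) hc hγ ha hb hα hsα (by linarith)
      (by linarith) z q hi h1 h3 h4
    refine hk.trans ?_
    rw [hexp z, mul_right_comm C 2, mul_assoc _ 2]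
    refine mul_le_mul_of_nonneg_left ?_ (by positivity)
    have e0 : z (i.succAbove 0) + q 0 = z 0 + q 0 := by rw [hs0]
    rw [e0] at h2 ⊢
    have b1 := abs_rpow_neg_le h1 hβ (by linarith : _ ≤ μ)
    have b2 := one_add_abs_rpow_neg_mul_le h2 h3 hϱ0.le (by linarith : 0 ≤ (1 - ϱ) / 2)
      (by linarith : _ ≤ μ)
    have b3 := abs_rpow_neg_le h4 (by linarith : 0 ≤ 1 - (1 - ϱ) / 2) (by linarith : _ ≤ μ)
    have b12 := mul_le_mul b1 b2 (by positivity) (by positivity)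
    have b123 := mul_le_mul b12 b3 (by positivity) (by positivity)
    refine (Eq.trans_le ?_ b123).trans_eq ?_ <;> ring

/-- For 0 < ϱ < 1 and 0 ≤ α ≤ η the weighted integral ∫ k̄(p,q) w_{−ϱ,α}(p) dp is bounded
uniformly in q. -/
theorem kernel_weighted_integral_bounded (c γ a b ς η : ℝ) (hc : 0 < c) (hγ : 0 < γ)
    (ha : 0 ≤ a) (hb : 0 ≤ b) (hbς : 0 < b + |ς|) (hbς2 : b + |ς| < 1 / 2)
    (hsum : 3 * |ς| + a + 2 * b < 2) (hη : η = 1 - (3 * |ς| + a + 2 * b) / 2)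
    (ϱ α : ℝ) (hϱ0 : 0 < ϱ) (hϱ1 : ϱ < 1) (hα0 : 0 ≤ α) (hαη : α ≤ η) :
    ∃ C > 0, ∀ q : Fin 3 → ℝ,
      ∫⁻ p : Fin 3 → ℝ, ENNReal.ofReal (kbar c γ a b ς p q * wgt c ϱ α p) ≤
        ENNReal.ofReal C := by
  set μ := max ((1 + ϱ) / 2) (1 / 2 + (b + |ς|))
  have hμ0 : 0 < μ := lt_max_of_lt_left (by linarith)
  have hμ1 : μ < 1 := max_lt (by linarith) (by linarith)
  obtain ⟨K, hK⟩ := exists_ofReal_kbar_mul_wgt_le (μ := μ) hc hγ ha hb hα0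
    (by linarith : (3 * |ς| + a + 2 * b) / 2 + α ≤ 1) hϱ0 hϱ1 (le_max_left _ _) (le_max_right _ _)
  obtain ⟨M, hMtop, hM⟩ := exists_lintegral_expDamp_mul_singMaj_le (by positivity : 0 < γ / 6)
    hμ0 hμ1
  have htop : ENNReal.ofReal K * (M * ((M + M) * M)) ≠ ∞ := by finiteness
  refine ⟨(ENNReal.ofReal K * (M * ((M + M) * M))).toReal + 1, by positivity, fun q => ?_⟩
  obtain ⟨i, s, u, v, w, hu, hv, hw, hz⟩ := hK q
  have hslices := lintegral_fin_three_le_of_slices i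
    (f := fun x => expDamp (γ / 6) x * singMaj μ (x + s))
    (g := fun x y => expDamp (γ / 6) y * (singMaj μ (y + u x) + singMaj μ (y + v x)))
    (h := fun x y => expDamp (γ / 6) y * singMaj μ (y + w x))
    (by fun_prop) (by unfold Function.uncurry; fun_prop) (by unfold Function.uncurry; fun_prop)
    (hM s) (B := M + M)
    (fun x => by
      simp only [mul_add]
      rw [lintegral_add_left (by fun_prop)]
      exact add_le_add (hM _) (hM _))
    (fun x => hM _)
  calc ∫⁻ p : Fin 3 → ℝ, ENNReal.ofReal (kbar c γ a b ς p q * wgt c ϱ α p)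
      = ∫⁻ z : Fin 3 → ℝ, ENNReal.ofReal (kbar c γ a b ς (z + q) q * wgt c ϱ α (z + q)) :=
        (lintegral_add_right_eq_self
          (fun p => ENNReal.ofReal (kbar c γ a b ς p q * wgt c ϱ α p)) q).symm
    _ ≤ _ := lintegral_mono hz
    _ ≤ ENNReal.ofReal K * (M * ((M + M) * M)) := by
        rw [lintegral_const_mul' _ _ ENNReal.ofReal_ne_top]
        gcongr
    _ = ENNReal.ofReal (ENNReal.ofReal K * (M * ((M + M) * M))).toReal :=
        (ENNReal.ofReal_toReal htop).symm
    _ ≤ _ := ENNReal.ofReal_le_ofReal (by linarith)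
end
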